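/- Let k = F_q(T), n | q-1, and let P_1, ..., P_r be distinct monic irreducible polynomials and e_1, ..., e_r divisors of n. The extension M = F_{q^n}(T, P_1^{1/e_1}, ..., P_r^{1/e_r}) of k is abelian with Galois group isomorphic to ℤ/nℤ × ℤ/e_1ℤ × ⋯ × ℤ/e_rℤ. -/

import Mathlib

set_option synthInstance.maxHeartbeats 1000000

open Polynomial in
theorem kummer_aux {K Ω ι : Type*} [Field K] [Field Ω] [Algebra K Ω] [Normal K Ω] [Fintype ι]
    (n : ℕ) (hn : 0 < n) (ζ : K) (hζ : IsPrimitiveRoot ζ n)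
    (m : ι → ℕ) (hm : ∀ i, m i ∣ n) (g : ι → K) (hg : ∀ i, g i ≠ 0)
    (y : ι → Ω) (hy : ∀ i, y i ^ m i = algebraMap K Ω (g i))
    (hind : ∀ a : ι → ℕ, (∃ w : K, w ^ n = ∏ i, g i ^ (a i * (n / m i))) → ∀ i, m i ∣ a i) :
    IsGalois K (IntermediateField.adjoin K (Set.range y)) ∧
    Nonempty (((IntermediateField.adjoin K (Set.range y)) ≃ₐ[K]
      (IntermediateField.adjoin K (Set.range y))) ≃* (∀ i, Multiplicative (ZMod (m i)))) := by
  classical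
  have hm0 : ∀ i, 0 < m i := fun i => Nat.pos_of_dvd_of_pos (hm i) hn
  have : NeZero n := ⟨hn.ne'⟩
  have : ∀ i, NeZero (m i) := fun i => ⟨(hm0 i).ne'⟩
  have hζi : ∀ i, IsPrimitiveRoot (ζ ^ (n / m i)) (m i) := fun i =>
    hζ.pow hn (Nat.div_mul_cancel (hm i)).symm
  have hy0 : ∀ i, y i ≠ 0 := fun i h => by
    have := hy i
    rw [h, zero_pow (hm0 i).ne'] at this
    exact hg i ((map_eq_zero _).1 this.symm)
  have key : ∀ i (x : Ω), x ^ m i = algebraMap K Ω (g i) →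
      ∃ u : rootsOfUnity (m i) K, x = algebraMap K Ω ((u : Kˣ) : K) * y i := by
    intro i x hx
    have h1 : (x / y i) ^ m i = 1 := by
      rw [div_pow, hx, hy, div_self]
      exact (_root_.map_ne_zero _).2 (hg i)
    have h2 : IsPrimitiveRoot (algebraMap K Ω (ζ ^ (n / m i))) (m i) :=
      (hζi i).map_of_injective (algebraMap K Ω).injective
    obtain ⟨j, -, hj⟩ := h2.eq_pow_of_pow_eq_one h1
    refine ⟨rootsOfUnity.mkOfPowEq ((ζ ^ (n / m i)) ^ j) ?_, ?_⟩
    · rw [← pow_mul, mul_comm, pow_mul, (hζi i).pow_eq_one, one_pow]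
    · rw [rootsOfUnity.coe_mkOfPowEq, map_pow, hj, div_mul_cancel₀ _ (hy0 i)]
  set L := IntermediateField.adjoin K (Set.range y) with hL
  have hyL : ∀ i, y i ∈ L := fun i => IntermediateField.subset_adjoin _ _ ⟨i, rfl⟩
  have hnormal : Normal K L := by
    rw [IntermediateField.normal_iff_forall_map_le]
    intro σ
    rw [hL, IntermediateField.adjoin_map, IntermediateField.adjoin_le_iff]
    rintro _ ⟨_, ⟨i, rfl⟩, rfl⟩
    obtain ⟨u, hu⟩ := key i (σ (y i)) (by rw [← map_pow, hy, AlgHom.commutes])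
    show σ (y i) ∈ L
    rw [hu]
    exact L.mul_mem (L.algebraMap_mem _) (hyL i)
  have hsep : Algebra.IsSeparable K L := by
    rw [hL, IntermediateField.isSeparable_adjoin_iff_isSeparable]
    rintro _ ⟨i, rfl⟩
    have h1 : (X ^ m i - C (g i)).Separable :=
      separable_X_pow_sub_C _ (hζi i).neZero'.out (hg i)
    refine h1.of_dvd (minpoly.dvd _ _ ?_)
    simp [hy]
  have hgal : IsGalois K L := ⟨⟩
  have hfin : FiniteDimensional K L :=
    IntermediateField.finiteDimensional_adjoin (fun x _ => Algebra.IsIntegral.isIntegral x)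
  refine ⟨hgal, ?_⟩
  let Y : ι → L := fun i => ⟨y i, hyL i⟩
  have hY0 : ∀ i, Y i ≠ 0 := fun i h => hy0 i (congrArg Subtype.val h)
  have hYm : ∀ i, Y i ^ m i = algebraMap K L (g i) := fun i => Subtype.ext (hy i)
  have hch : ∀ (σ : L ≃ₐ[K] L) (i : ι), ∃ u : rootsOfUnity (m i) K,
      σ (Y i) = algebraMap K L ((u : Kˣ) : K) * Y i := by
    intro σ i
    obtain ⟨u, hu⟩ := key i ((σ (Y i) : L) : Ω) (by
      have : (σ (Y i)) ^ m i = algebraMap K L (g i) := by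
        rw [← map_pow, hYm, AlgEquiv.commutes]
      exact congrArg Subtype.val this)
    exact ⟨u, Subtype.ext hu⟩
  choose χ hχ using hch
  have huniq : ∀ i (u v : rootsOfUnity (m i) K),
      algebraMap K L ((u : Kˣ) : K) * Y i = algebraMap K L ((v : Kˣ) : K) * Y i → u = v := by
    intro i u v h
    exact Subtype.ext (Units.ext ((algebraMap K L).injective (mul_right_cancel₀ (hY0 i) h)))
  let φ : (L ≃ₐ[K] L) →* (∀ i, rootsOfUnity (m i) K) :=
    { toFun := χ
      map_one' := by
        funext i
        apply huniq
        rw [← hχ]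
        simp
      map_mul' := by
        intro σ τ
        funext i
        apply huniq
        rw [← hχ, AlgEquiv.mul_apply, hχ τ, map_mul, AlgEquiv.commutes, hχ σ]
        simp only [Pi.mul_apply, Subgroup.coe_mul, Units.val_mul, map_mul]
        ring }
  have hinj : Function.Injective φ := by
    intro σ τ h
    have : (σ : L →ₐ[K] L) = (τ : L →ₐ[K] L) := by
      apply IntermediateField.algHom_ext_of_eq_adjoin K hL
      rintro _ ⟨i, rfl⟩
      show σ (Y i) = τ (Y i)
      rw [hχ, hχ]
      have : χ σ i = χ τ i := congrFun h i
      rw [this]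
    exact AlgEquiv.ext fun x => DFunLike.congr_fun this x
  have hsurj : Function.Surjective φ := by
    rw [← MonoidHom.range_eq_top]
    by_contra hne
    obtain ⟨b, hb⟩ : ∃ b, b ∉ φ.range := by
      by_contra! hall
      exact hne (eq_top_iff.2 fun x _ => hall x)
    let Q := (∀ i, rootsOfUnity (m i) K) ⧸ φ.range
    have : HasEnoughRootsOfUnity K n := ⟨⟨ζ, hζ⟩, inferInstance⟩
    have hexp : Monoid.exponent Q ∣ n := by
      apply Monoid.exponent_dvd_of_forall_pow_eq_one
      intro x
      obtain ⟨x, rfl⟩ := QuotientGroup.mk_surjective x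
      rw [← QuotientGroup.mk_pow]
      have : x ^ n = 1 := by
        funext i
        apply Subtype.ext
        obtain ⟨c, hc⟩ := hm i
        have := (x i).2
        rw [mem_rootsOfUnity] at this
        simp only [Pi.pow_apply, Subgroup.coe_pow, Pi.one_apply, Subgroup.coe_one]
        rw [hc, pow_mul, this, one_pow]
      rw [this]; rfl
    have := HasEnoughRootsOfUnity.of_dvd K hexp
    have hb1 : (QuotientGroup.mk b : Q) ≠ 1 := by
      rwa [Ne, QuotientGroup.eq_one_iff]
    obtain ⟨ψ', hψ'⟩ := CommGroup.exists_apply_ne_one_of_hasEnoughRootsOfUnity Q K hb1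
    let ψ : (∀ i, rootsOfUnity (m i) K) →* Kˣ := ψ'.comp (QuotientGroup.mk' φ.range)
    have hψφ : ∀ σ, ψ (φ σ) = 1 := by
      intro σ
      have : (QuotientGroup.mk (φ σ) : Q) = 1 := (QuotientGroup.eq_one_iff _).2 ⟨σ, rfl⟩
      show ψ' (QuotientGroup.mk (φ σ)) = 1
      rw [this, map_one]
    have hψb : ψ b ≠ 1 := hψ'
    -- every component is a power map
    have hcomp : ∀ i, ∃ k : ℕ, ∀ u : rootsOfUnity (m i) K,
        ψ (Pi.mulSingle i u) = (u : Kˣ) ^ k := by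
      intro i
      let z : rootsOfUnity (m i) K := (hζi i).toRootsOfUnity
      have hzp : ((z : Kˣ) : K) = ζ ^ (n / m i) := rfl
      have h1 : ((ψ (Pi.mulSingle i z) : Kˣ) : K) ^ m i = 1 := by
        rw [← Units.val_pow_eq_pow_val, ← map_pow, ← Pi.mulSingle_pow]
        have : z ^ m i = 1 := Subtype.ext z.2
        rw [this]; simp
      obtain ⟨k, -, hk⟩ := (hζi i).eq_pow_of_pow_eq_one h1
      refine ⟨k, fun u => ?_⟩
      have h2 : ((u : Kˣ) : K) ^ m i = 1 := by
        rw [← Units.val_pow_eq_pow_val, u.2]; rfl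
      obtain ⟨j, -, hj⟩ := (hζi i).eq_pow_of_pow_eq_one h2
      have hu : u = z ^ j := by
        apply Subtype.ext; apply Units.ext
        rw [← hj]; simp [hzp]
      rw [hu, Pi.mulSingle_pow, map_pow]
      apply Units.ext
      simp only [Units.val_pow_eq_pow_val, Subgroup.coe_pow]
      rw [← hk, hzp]
      ring
    choose a ha using hcomp
    have hψ : ∀ x, ψ x = ∏ i, (x i : Kˣ) ^ a i := by
      intro x
      conv_lhs => rw [← Finset.univ_prod_mulSingle x, map_prod]
      exact Finset.prod_congr rfl fun i _ => ha i _
    have hfix : (∏ i, Y i ^ a i) ∈ (⊥ : IntermediateField K L) := by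
      rw [IsGalois.mem_bot_iff_fixed]
      intro σ
      rw [map_prod]
      have h1 : ∀ i, σ (Y i ^ a i) =
          algebraMap K L ((((χ σ i : Kˣ) ^ a i : Kˣ)) : K) * Y i ^ a i := by
        intro i
        rw [map_pow, hχ, mul_pow]; simp
      rw [Finset.prod_congr rfl fun i _ => h1 i, Finset.prod_mul_distrib, ← map_prod,
        ← Units.coe_prod]
      have h2 : ∏ i, (χ σ i : Kˣ) ^ a i = 1 := by
        have := hψφ σ
        rw [hψ] at this
        exact this
      rw [h2]; simp
    rw [IntermediateField.mem_bot] at hfix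
    obtain ⟨w, hw⟩ := hfix
    have hdiv := hind a ⟨w, by
      apply (algebraMap K L).injective
      rw [map_pow, hw, map_prod, ← Finset.prod_pow]
      refine Finset.prod_congr rfl fun i _ => ?_
      rw [map_pow, ← hYm, ← pow_mul, ← pow_mul]
      congr 1
      rw [mul_left_comm, Nat.mul_div_cancel' (hm i)]⟩
    apply hψb
    rw [hψ]
    refine Finset.prod_eq_one fun i _ => ?_
    obtain ⟨c, hc⟩ := hdiv i
    have := (b i).2
    rw [mem_rootsOfUnity] at this
    rw [hc, pow_mul, this, one_pow]
  refine ⟨(MulEquiv.ofBijective φ ⟨hinj, hsurj⟩).trans (MulEquiv.piCongrRight fun i => ?_)⟩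
  have := rootsOfUnity.isCyclic K (m i)
  exact mulEquivOfCyclicCardEq (by
    rw [(hζi i).card_rootsOfUnity]; simp)

open Polynomial in
theorem indep_aux (F : Type*) [Field F] [Fintype F] (n r : ℕ)
    (hn : 0 < n) (hd : n ∣ Fintype.card F - 1)
    (P : Fin r → Polynomial F)
    (hPmonic : ∀ i, (P i).Monic) (hPirr : ∀ i, Irreducible (P i))
    (hPdist : Function.Injective P)
    (e : Fin r → ℕ) (hediv : ∀ i, e i ∣ n)
    (c : F) (hc0 : c ≠ 0) (hc : ∀ x : F, x ≠ 0 → ∃ j : ℕ, c ^ j = x)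
    (hco : orderOf c = Fintype.card F - 1)
    (a0 : ℕ) (a : Fin r → ℕ) (w : RatFunc F)
    (hw : w ^ n = algebraMap F[X] (RatFunc F) (C c ^ a0 * ∏ i, P i ^ (a i * (n / e i)))) :
    n ∣ a0 ∧ ∀ i, e i ∣ a i := by
  obtain ⟨p, rfl⟩ := IsIntegrallyClosed.exists_algebraMap_eq_of_isIntegral_pow (R := F[X]) hn
    (hw ▸ isIntegral_algebraMap)
  rw [← map_pow] at hw
  replace hw := IsFractionRing.injective F[X] (RatFunc F) hw
  have hprod : (∏ i, P i ^ (a i * (n / e i))).Monic :=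
    monic_prod_of_monic _ _ fun i _ => (hPmonic i).pow _
  constructor
  · have hl : p.leadingCoeff ^ n = c ^ a0 := by
      rw [← leadingCoeff_pow, hw, leadingCoeff_mul, hprod.leadingCoeff]
      simp
    have hp0 : p.leadingCoeff ≠ 0 := by
      intro h
      rw [h, zero_pow hn.ne'] at hl
      exact pow_ne_zero _ hc0 hl.symm
    obtain ⟨s, hs⟩ := hc _ hp0
    rw [← hs, ← pow_mul] at hl
    have h1 : s * n ≡ a0 [MOD orderOf c] := by
      have hu : IsUnit c := hc0.isUnit
      obtain ⟨u, rfl⟩ := hu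
      rw [orderOf_units, ← pow_eq_pow_iff_modEq]
      exact Units.ext (by simpa using hl)
    rw [hco] at h1
    have h2 := (h1.of_dvd hd)
    exact (Nat.ModEq.dvd_iff h2 dvd_rfl).1 (dvd_mul_left _ _)
  · intro i
    have hpr : Prime (P i) := (hPirr i).prime
    have hp0 : p ≠ 0 := by
      rintro rfl
      rw [zero_pow hn.ne'] at hw
      exact mul_ne_zero (pow_ne_zero _ (C_ne_zero.2 hc0)) hprod.ne_zero hw.symm
    have h1 := congrArg (emultiplicity (P i)) hw
    rw [emultiplicity_pow hpr, emultiplicity_mul hpr, emultiplicity_pow hpr,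
      Finset.emultiplicity_prod hpr, Finset.sum_eq_single i, emultiplicity_pow hpr] at h1
    · have h2 : emultiplicity (P i) (P i) = 1 := by
        have : FiniteMultiplicity (P i) (P i) :=
          FiniteMultiplicity.of_prime_left hpr hpr.ne_zero
        rw [this.emultiplicity_self]
      have h3 : emultiplicity (P i) (C c) = 0 := by
        apply emultiplicity_eq_zero.2
        intro h
        exact hpr.not_isUnit (isUnit_of_dvd_unit h (isUnit_C.2 hc0.isUnit))
      have h4 : FiniteMultiplicity (P i) p := FiniteMultiplicity.of_prime_left hpr hp0
      rw [h2, h3, h4.emultiplicity_eq_multiplicity] at h1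
      have h5 : n * multiplicity (P i) p = a i * (n / e i) := by
        have : ((n * multiplicity (P i) p : ℕ) : ℕ∞) = ((a i * (n / e i) : ℕ) : ℕ∞) := by
          push_cast at h1 ⊢
          simpa using h1
        exact_mod_cast this
      obtain ⟨d, hd'⟩ := hediv i
      have he : 0 < e i := Nat.pos_of_dvd_of_pos (hediv i) hn
      have hd0 : 0 < d := Nat.pos_of_ne_zero (by rintro rfl; simp at hd'; omega)
      rw [hd', Nat.mul_div_cancel_left _ he] at h5
      refine ⟨multiplicity (P i) p, Nat.eq_of_mul_eq_mul_right hd0 ?_⟩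
      rw [← h5]; ring
    · intro j _ hj
      apply emultiplicity_eq_zero.2
      intro h
      have h6 := hpr.dvd_of_dvd_pow h
      have h7 := (hPirr i).associated_of_dvd (hPirr j) h6
      exact hj (hPdist (eq_of_monic_of_associated (hPmonic i) (hPmonic j) h7).symm)
    · simp

theorem const_pow_aux (F Ω : Type*) [Field F] [Fintype F] [Field Ω] [Algebra F Ω] (n : ℕ)
    (hd : n ∣ Fintype.card F - 1) (c : F) (y : Ω) (hy : y ^ n = algebraMap F Ω c) (j : ℕ) :
    y ^ (Fintype.card F ^ j) =
      algebraMap F Ω ((c ^ ((Fintype.card F - 1) / n)) ^ j) * y := by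
  induction j with
  | zero => simp
  | succ j ih =>
    have h1 : y ^ Fintype.card F = algebraMap F Ω (c ^ ((Fintype.card F - 1) / n)) * y := by
      have : Fintype.card F = n * ((Fintype.card F - 1) / n) + 1 := by
        rw [Nat.mul_div_cancel' hd]
        have := Fintype.card_pos (α := F)
        omega
      conv_lhs => rw [this, pow_succ, pow_mul, hy, ← map_pow]
    rw [pow_succ, pow_mul, ih, mul_pow, ← map_pow, FiniteField.pow_card, h1, ← mul_assoc,
      ← map_mul, ← pow_succ]

open Polynomial in
theorem const_aux (F Ω : Type*) [Field F] [Fintype F] [Field Ω] [Algebra F Ω] (n : ℕ)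
    (hn : 0 < n) (hd : n ∣ Fintype.card F - 1) (c : F) (hc0 : c ≠ 0)
    (hco : IsPrimitiveRoot (c ^ ((Fintype.card F - 1) / n)) n)
    (y : Ω) (hy : y ^ n = algebraMap F Ω c) (x : Ω) (hx : x ^ (Fintype.card F ^ n) = x) :
    x ∈ IntermediateField.adjoin F {y} := by
  classical
  have hy0 : y ≠ 0 := by
    rintro rfl
    rw [zero_pow hn.ne'] at hy
    exact hc0 ((map_eq_zero _).1 hy.symm)
  have hint : IsIntegral F y := by
    refine IsIntegral.of_pow hn ?_
    rw [hy]; exact isIntegral_algebraMap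
  have : FiniteDimensional F (IntermediateField.adjoin F {y}) :=
    IntermediateField.adjoin.finiteDimensional hint
  have hfin : Finite (IntermediateField.adjoin F {y}) := Module.finite_of_finite F
  let _ : Fintype (IntermediateField.adjoin F {y}) := Fintype.ofFinite _
  have hcard := Module.card_eq_pow_finrank (K := F) (V := IntermediateField.adjoin F {y})
  set d := Module.finrank F (IntermediateField.adjoin F {y})
  have hall : ∀ z ∈ IntermediateField.adjoin F {y}, z ^ (Fintype.card F ^ d) = z := by
    intro z hz
    have := FiniteField.pow_card (⟨z, hz⟩ : IntermediateField.adjoin F {y})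
    rw [hcard] at this
    exact congrArg Subtype.val this
  have hnd : n ∣ d := by
    have h1 := hall y (IntermediateField.mem_adjoin_simple_self F y)
    rw [const_pow_aux F Ω n hd c y hy] at h1
    have h2 := mul_right_cancel₀ hy0 (h1.trans (one_mul y).symm)
    apply hco.dvd_of_pow_eq_one
    exact (algebraMap F Ω).injective (h2.trans (map_one _).symm)
  have hxd : x ^ (Fintype.card F ^ d) = x := by
    obtain ⟨t, ht⟩ := hnd
    rw [ht, pow_mul]
    clear ht
    induction t with
    | zero => simp
    | succ t ih => rw [pow_succ, pow_mul, ih, hx]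
  have hN : 1 < Fintype.card F ^ d := by rw [← hcard]; exact Fintype.one_lt_card
  have hne : (X ^ (Fintype.card F ^ d) - X : Polynomial Ω) ≠ 0 :=
    FiniteField.X_pow_card_sub_X_ne_zero Ω hN
  let S : Finset Ω := Finset.univ.map
    ⟨((↑) : IntermediateField.adjoin F {y} → Ω), Subtype.val_injective⟩
  have hS : S = (X ^ (Fintype.card F ^ d) - X : Polynomial Ω).roots.toFinset := by
    apply Finset.eq_of_subset_of_card_le
    · intro z hz
      obtain ⟨z, -, rfl⟩ := Finset.mem_map.1 hz
      rw [Multiset.mem_toFinset, mem_roots hne]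
      simp only [Function.Embedding.coeFn_mk, IsRoot.def, eval_sub, eval_pow, eval_X]
      rw [hall _ z.2, sub_self]
    · refine (Multiset.toFinset_card_le _).trans ((card_roots' _).trans ?_)
      rw [FiniteField.X_pow_card_sub_X_natDegree_eq Ω hN, Finset.card_map, Finset.card_univ, hcard]
  have hxS : x ∈ S := by
    rw [hS, Multiset.mem_toFinset, mem_roots hne]
    simp [hxd]
  obtain ⟨z, -, hz⟩ := Finset.mem_map.1 hxS
  rw [← hz]; exact z.2


/-- With `k = F_q(T)`, `n ∣ q - 1`, distinct monic irreducibles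
`P_i` and `e_i ∣ n`, the extension `M = F_{q^n}(T, P_1^{1/e_1}, …, P_r^{1/e_r})`
of `k` is abelian (indeed Galois) with Galois group
`ℤ/nℤ × ℤ/e_1ℤ × ⋯ × ℤ/e_rℤ`. -/
theorem stmt_14 (F : Type*) [Field F] [Fintype F] (q n r : ℕ)
    (hq : Fintype.card F = q) (hn : 0 < n) (hd : n ∣ q - 1)
    (P : Fin r → Polynomial F)
    (hPmonic : ∀ i, (P i).Monic) (hPirr : ∀ i, Irreducible (P i))
    (hPdist : Function.Injective P)
    (e : Fin r → ℕ) (hepos : ∀ i, 0 < e i) (hediv : ∀ i, e i ∣ n)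
    (y : Fin r → AlgebraicClosure (RatFunc F))
    (hy : ∀ i, (y i) ^ (e i) =
      algebraMap (RatFunc F) (AlgebraicClosure (RatFunc F))
        (algebraMap (Polynomial F) (RatFunc F) (P i))) :
    IsGalois (RatFunc F)
      (IntermediateField.adjoin (RatFunc F)
        ({x : AlgebraicClosure (RatFunc F) | x ^ (q ^ n) = x} ∪ Set.range y)) ∧
    Nonempty
      ((IntermediateField.adjoin (RatFunc F)
          ({x : AlgebraicClosure (RatFunc F) | x ^ (q ^ n) = x} ∪ Set.range y) ≃ₐ[RatFunc F]
        IntermediateField.adjoin (RatFunc F)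
          ({x : AlgebraicClosure (RatFunc F) | x ^ (q ^ n) = x} ∪ Set.range y)) ≃*
        (Multiplicative (ZMod n) × ∀ i : Fin r, Multiplicative (ZMod (e i)))) := by
  classical
  subst hq
  obtain ⟨cu, hcu⟩ := IsCyclic.exists_generator (α := Fˣ)
  have hco : orderOf cu = Fintype.card F - 1 := by
    rw [orderOf_eq_card_of_forall_mem_zpowers hcu, Nat.card_eq_fintype_card, Fintype.card_units]
  have hcard1 : 0 < Fintype.card F - 1 := by
    have := Fintype.one_lt_card (α := F)
    omega
  have hco' : orderOf (cu : F) = Fintype.card F - 1 := by rw [orderOf_units, hco]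
  have hprim : IsPrimitiveRoot ((cu : F) ^ ((Fintype.card F - 1) / n)) n := by
    have := IsPrimitiveRoot.orderOf (cu : F)
    rw [hco'] at this
    exact this.pow hcard1 (Nat.div_mul_cancel hd).symm
  obtain ⟨y0, hy0⟩ := IsAlgClosed.exists_pow_nat_eq (algebraMap F (AlgebraicClosure (RatFunc F)) (cu : F)) hn
  let m : Option (Fin r) → ℕ := fun o => o.elim n e
  let g : Option (Fin r) → RatFunc F := fun o =>
    o.elim (algebraMap F (RatFunc F) cu) fun i => algebraMap (Polynomial F) (RatFunc F) (P i)
  let Y : Option (Fin r) → (AlgebraicClosure (RatFunc F)) := fun o => o.elim y0 y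
  have hadj : IntermediateField.adjoin (RatFunc F)
        ({x : (AlgebraicClosure (RatFunc F)) | x ^ (Fintype.card F ^ n) = x} ∪ Set.range y) =
      IntermediateField.adjoin (RatFunc F) (Set.range Y) := by
    apply le_antisymm
    · rw [IntermediateField.adjoin_le_iff]
      rintro x (hx | ⟨i, rfl⟩)
      · have h1 := const_aux F (AlgebraicClosure (RatFunc F)) n hn hd cu cu.ne_zero hprim y0 hy0 x hx
        have h2 : IntermediateField.adjoin F {y0} ≤
            (IntermediateField.adjoin (RatFunc F) (Set.range Y)).restrictScalars F := by
          rw [IntermediateField.adjoin_le_iff]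
          rintro _ rfl
          exact IntermediateField.subset_adjoin (RatFunc F) (Set.range Y) ⟨none, rfl⟩
        exact h2 h1
      · exact IntermediateField.subset_adjoin _ _ ⟨some i, rfl⟩
    · apply IntermediateField.adjoin.mono
      rintro _ ⟨_ | i, rfl⟩
      · left
        show y0 ^ (Fintype.card F ^ n) = y0
        rw [const_pow_aux F (AlgebraicClosure (RatFunc F)) n hd cu y0 hy0, hprim.pow_eq_one]
        simp
      · right; exact ⟨i, rfl⟩
  rw [hadj]
  have hK := kummer_aux (K := RatFunc F) (Ω := AlgebraicClosure (RatFunc F)) n hn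
    (algebraMap F (RatFunc F) ((cu : F) ^ ((Fintype.card F - 1) / n)))
    (hprim.map_of_injective (algebraMap F (RatFunc F)).injective) m
    (by rintro (_ | i); exacts [dvd_rfl, hediv i]) g
    (by
      rintro (_ | i)
      · exact (map_ne_zero _).2 cu.ne_zero
      · exact RatFunc.algebraMap_ne_zero (hPirr i).ne_zero) Y
    (by
      rintro (_ | i)
      · exact hy0.trans (IsScalarTower.algebraMap_apply F (RatFunc F) (AlgebraicClosure (RatFunc F)) _)
      · exact hy i)
    (by
      rintro a ⟨w, hw⟩
      have h := indep_aux F n r hn hd P hPmonic hPirr hPdist e hediv cu cu.ne_zero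
        (by
          intro x hx
          obtain ⟨j, hj⟩ := mem_powers_iff_mem_zpowers.2 (hcu (Units.mk0 x hx))
          exact ⟨j, by simpa using congrArg Units.val hj⟩)
        hco' (a none) (fun i => a (some i)) w (by
          rw [hw, Fintype.prod_option]
          simp only [g, m, Option.elim, Nat.div_self hn, mul_one, map_mul, map_pow, map_prod]
          rfl)
      rintro (_ | i)
      exacts [h.1, h.2 i])
  refine ⟨hK.1, hK.2.map fun f => f.trans ?_⟩
  exact
    { toFun := fun x => (x none, fun i => x (some i))
      invFun := fun p o => match o with
        | none => p.1
        | some i => p.2 i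
      left_inv := by
        intro x; funext o; cases o <;> rfl
      right_inv := by intro p; rfl
      map_mul' := by intro x y; rfl }
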